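/- Let ℙ be a probability measure on Ω₊ under which (ω(x))_{x≥0} is stationary (respectively, stationary and ergodic). Then the sequence ξ = (ξ_k)_{k≥0}, where ξ_k := ((ω(x + k))_{x≥0}, (X_{τ_{k,m}} − k)_{m≥0}) consists of the environment to the right of k together with the part of the trajectory at sites ≥ k recentered at k, is stationary (respectively, stationary and ergodic) under the annealed measure P_0. In particular, for any measurable function g on ([1/2,1]^ℕ)^{ℕ₀} × ℤ^{ℕ₀}, the sequence (g(ξ_k))_{k≥0} is stationary (respectively, ergodic) under P_0 whenever (ω(x))_{x≥0} is so under ℙ. -/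

import Mathlib

open MeasureTheory Filter Set Topology ProbabilityTheory
open scoped ENNReal ENat

noncomputable section

/-- A cookie environment: `ω z i` is the strength of the `(i+1)`-st cookie at site `z`
(cookies at each site are indexed by `i = 0, 1, 2, …`). -/
abbrev CEnv : Type := ℤ → ℕ → ℝ

/-- `ω` belongs to `Ω₊`, i.e. all cookie strengths lie in `[1/2, 1]`. -/
def IsCookieEnv (ω : CEnv) : Prop := ∀ z i, ω z i ∈ Set.Icc (1/2 : ℝ) 1

/-- The number of visits of the path `x` to the site `x n` at times `m < n`. -/
def prevVisits (x : ℕ → ℤ) (n : ℕ) : ℕ :=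
  ((Finset.range n).filter fun m => x m = x n).card

/-- The probability of the step from `x n` to `x (n+1)` for the multi-excited random
walk: jump to the right with the strength of the bottom remaining cookie at the current
site, to the left with the complementary probability. -/
def stepProb (ω : CEnv) (x : ℕ → ℤ) (n : ℕ) : ℝ :=
  if x (n+1) = x n + 1 then ω (x n) (prevVisits x n)
  else if x (n+1) = x n - 1 then 1 - ω (x n) (prevVisits x n)
  else 0

/-- The probability that the walk started at `x0` follows the path `x` up to time `n`. -/
def cylProb (ω : CEnv) (x0 : ℤ) (x : ℕ → ℤ) (n : ℕ) : ℝ :=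
  (if x 0 = x0 then 1 else 0) * ∏ m ∈ Finset.range n, stepProb ω x m

/-- `P` is the law `P_{x0,ω}` of the multi-excited random walk in the cookie
environment `ω` started at `x0`, characterized by its cylinder probabilities. -/
def IsERWLaw (ω : CEnv) (x0 : ℤ) (P : Measure (ℕ → ℤ)) : Prop :=
  IsProbabilityMeasure P ∧
    ∀ (x : ℕ → ℤ) (n : ℕ),
      P {Y | ∀ m ≤ n, Y m = x m} = ENNReal.ofReal (cylProb ω x0 x n)

/-- First passage time `T_k`, with value `∞` if `k` is never visited. -/
def T (k : ℤ) (Y : ℕ → ℤ) : ℕ∞ :=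
  sInf {t : ℕ∞ | ∃ n : ℕ, (n : ℕ∞) = t ∧ Y n = k}

/-- First passage time of an extended-real level, with the convention
`T_{−∞} = T_{+∞} = ∞`. -/
def Te (k : EReal) (Y : ℕ → ℤ) : ℕ∞ :=
  sInf {t : ℕ∞ | ∃ n : ℕ, (n : ℕ∞) = t ∧ ((Y n : ℝ) : EReal) = k}

/-- `R_k`, the event that the site `k` is visited infinitely often. -/
def Rset (k : ℤ) : Set (ℕ → ℤ) := {Y | ∀ N : ℕ, ∃ n ≥ N, Y n = k}

/-- The number of visits of `Y` to the site `s` at times `< t`. -/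
def visitsBefore (Y : ℕ → ℤ) (s : ℤ) (t : ℕ∞) : ℕ∞ :=
  {m : ℕ | (m : ℕ∞) < t ∧ Y m = s}.encard

/-- `D_t^s`: the total drift stored in the cookies consumed at the site `s`
before time `t` (a time in `ℕ∞`; `t = ∞` gives `D_∞^s`). -/
def driftAt (ω : CEnv) (Y : ℕ → ℤ) (s : ℤ) (t : ℕ∞) : ℝ≥0∞ :=
  ∑' i : ℕ, Set.indicator {i : ℕ | (i : ℕ∞) < visitsBefore Y s t}
    (fun i => ENNReal.ofReal (2 * ω s i - 1)) i

/-- `D_t`: the total drift consumed before time `t` (at all sites). -/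
def Dtot (ω : CEnv) (Y : ℕ → ℤ) (t : ℕ∞) : ℝ≥0∞ := ∑' s : ℤ, driftAt ω Y s t

/-- `D_t^+`: the total drift consumed at nonnegative sites before time `t`. -/
def DtotPos (ω : CEnv) (Y : ℕ → ℤ) (t : ℕ∞) : ℝ≥0∞ := ∑' s : ℕ, driftAt ω Y (s : ℤ) t

/-- `δ^s`: the total drift stored in the cookies at the site `s`. -/
def cookieDrift (ω : CEnv) (s : ℤ) : ℝ≥0∞ := ∑' i : ℕ, ENNReal.ofReal (2 * ω s i - 1)

/-- The successive times `τ_{k,1}, τ_{k,2}, …` (indexed here from `0`) at which the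
walk is at a site `≥ k`. -/
def tauT (k : ℤ) (Y : ℕ → ℤ) : ℕ → ℕ∞
  | 0 => sInf {t : ℕ∞ | ∃ n : ℕ, (n : ℕ∞) = t ∧ k ≤ Y n}
  | m + 1 => sInf {t : ℕ∞ | ∃ n : ℕ, (n : ℕ∞) = t ∧ tauT k Y m < (n : ℕ∞) ∧ k ≤ Y n}

/-- The observed sequence `(X_{τ_{k,m}})_{m ≥ 1}` (indexed here from `0`). -/
def obsSeq (k : ℤ) (Y : ℕ → ℤ) (m : ℕ) : ℤ := Y (tauT k Y m).toNat

/-- The one-sided shift on sequences. -/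
def shiftSeq {α : Type*} (u : ℕ → α) : ℕ → α := fun n => u (n + 1)

/-- The restriction `(ω(x))_{x ≥ 0}` of an environment to the nonnegative sites. -/
def restrictNN (ω : CEnv) : ℕ → ℕ → ℝ := fun x => ω (x : ℤ)

/-- `(ω(x))_{x ≥ 0}` is stationary under `Pr`: its law is invariant under the shift. -/
def IsStationaryEnv (Pr : Measure CEnv) : Prop :=
  MeasurePreserving shiftSeq (Pr.map restrictNN) (Pr.map restrictNN)

/-- `(ω(x))_{x ≥ 0}` is stationary and ergodic under `Pr`. -/
def IsStatErgEnv (Pr : Measure CEnv) : Prop :=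
  Ergodic shiftSeq (Pr.map restrictNN)

/-- The process `ξ_k = ((ω(x+k))_{x≥0}, (X_{τ_{k,m}} − k)_{m≥0})` consisting of the
environment to the right of `k` and the trajectory at sites `≥ k`, recentered at `k`. -/
def xiProc (p : CEnv × (ℕ → ℤ)) (k : ℕ) : (ℕ → ℕ → ℝ) × (ℕ → ℤ) :=
  (fun x : ℕ => p.1 ((x : ℤ) + (k : ℤ)), fun m => obsSeq (k : ℤ) p.2 m - (k : ℤ))

/-- Position and visit counts of the walk from `0` driven by the decision stacks `d`: at its
`(i+1)`-st visit to `z` the walk moves to `z + 1` if `d z i` and to `ℓ z` otherwise. -/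
def stackState (ℓ : ℤ → ℤ) (d : ℤ → ℕ → Bool) : ℕ → ℤ × (ℤ → ℕ)
  | 0 => (0, 0)
  | n + 1 =>
    let s := stackState ℓ d n
    (if d s.1 (s.2 s.1) then s.1 + 1 else ℓ s.1, Function.update s.2 s.1 (s.2 s.1 + 1))

/-- The walk driven by decision stacks. -/
def stackWalk (ℓ : ℤ → ℤ) (d : ℤ → ℕ → Bool) (n : ℕ) : ℤ := (stackState ℓ d n).1

/-- The number of visits of the walk driven by decision stacks to a site before time `n`. -/
def stackVisits (ℓ : ℤ → ℤ) (d : ℤ → ℕ → Bool) (n : ℕ) : ℤ → ℕ := (stackState ℓ d n).2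

section Stack

variable (ℓ : ℤ → ℤ) (d : ℤ → ℕ → Bool)

lemma stackWalk_zero : stackWalk ℓ d 0 = 0 := rfl

lemma stackVisits_zero (z : ℤ) : stackVisits ℓ d 0 z = 0 := rfl

lemma stackWalk_succ (n : ℕ) :
    stackWalk ℓ d (n + 1) =
      if d (stackWalk ℓ d n) (stackVisits ℓ d n (stackWalk ℓ d n)) then stackWalk ℓ d n + 1
      else ℓ (stackWalk ℓ d n) := rfl

lemma stackVisits_succ (n : ℕ) (z : ℤ) :
    stackVisits ℓ d (n + 1) z =
      stackVisits ℓ d n z + if stackWalk ℓ d n = z then 1 else 0 := by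
  have : stackVisits ℓ d (n + 1) = Function.update (stackVisits ℓ d n) (stackWalk ℓ d n)
    (stackVisits ℓ d n (stackWalk ℓ d n) + 1) := rfl
  rw [this, Function.update_apply]
  grind

lemma stackVisits_eq_card (n : ℕ) (z : ℤ) :
    stackVisits ℓ d n z = ((Finset.range n).filter fun m => stackWalk ℓ d m = z).card := by
  induction n with
  | zero => simp [stackVisits_zero]
  | succ n ih =>
    rw [stackVisits_succ, ih, Finset.range_add_one, Finset.filter_insert]
    split_ifs <;> simp

lemma stackVisits_self (n : ℕ) :
    stackVisits ℓ d n (stackWalk ℓ d n) = prevVisits (stackWalk ℓ d) n :=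
  stackVisits_eq_card ..

lemma stackVisits_eq_of_lt {k z : ℤ} (hz : k ≤ z) {a b : ℕ} (hab : a ≤ b)
    (h : ∀ n, a ≤ n → n < b → stackWalk ℓ d n < k) :
    stackVisits ℓ d b z = stackVisits ℓ d a z := by
  induction b, hab using Nat.le_induction with
  | base => rfl
  | succ b hab ih =>
    have := h b hab (Nat.lt_succ_self b)
    rw [stackVisits_succ, ih fun n h1 h2 => h n h1 (by omega), if_neg (by omega), add_zero]

lemma measurable_stackState (n : ℕ) : Measurable fun d => stackState ℓ d n := by
  induction n with
  | zero => exact measurable_const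
  | succ n ih =>
    have heval : Measurable fun d : ℤ → ℕ → Bool =>
        (stackState ℓ d n).2 (stackState ℓ d n).1 := by
      have : Measurable fun q : (ℤ → ℕ) × ℤ => q.1 q.2 :=
        measurable_from_prod_countable_left fun z => measurable_pi_apply z
      exact this.comp (ih.snd.prodMk ih.fst)
    have hdec : Measurable fun d : ℤ → ℕ → Bool =>
        d (stackState ℓ d n).1 ((stackState ℓ d n).2 (stackState ℓ d n).1) := by
      have : Measurable fun q : (ℤ → ℕ → Bool) × (ℤ × ℕ) => q.1 q.2.1 q.2.2 :=
        measurable_from_prod_countable_left fun z =>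
          (measurable_pi_apply z.2).comp (measurable_pi_apply z.1)
      exact this.comp (measurable_id.prodMk (ih.fst.prodMk heval))
    refine Measurable.prodMk ?_ (measurable_pi_iff.2 fun z => ?_)
    · refine Measurable.ite (hdec (measurableSet_singleton true)) ?_ ?_
      · exact ih.fst.add_const 1
      · exact (measurable_of_countable ℓ).comp ih.fst
    · simp only [Function.update_apply]
      refine Measurable.ite ?_ (heval.add_const 1) ((measurable_pi_apply z).comp ih.snd)
      exact measurableSet_eq_fun measurable_const ih.fst

lemma measurable_stackWalk : Measurable (stackWalk ℓ) :=
  measurable_pi_iff.2 fun n => (measurable_stackState ℓ n).fst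

end Stack

lemma exists_sInf_natCast_eq {p : ℕ → Prop} (h : ∃ n, p n) :
    ∃ n, p n ∧ (∀ j < n, ¬ p j) ∧ sInf {t : ℕ∞ | ∃ n : ℕ, (n : ℕ∞) = t ∧ p n} = n := by
  classical
  refine ⟨Nat.find h, Nat.find_spec h, fun j hj => Nat.find_min h hj, le_antisymm ?_ ?_⟩
  · exact sInf_le ⟨_, rfl, Nat.find_spec h⟩
  · refine le_sInf ?_
    rintro _ ⟨n, rfl, hn⟩
    exact_mod_cast Nat.find_min' h hn

lemma measurable_tauT (k : ℤ) (m : ℕ) : Measurable fun Y => tauT k Y m := by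
  have key : ∀ p : (ℕ → ℤ) → ℕ → Prop, (∀ n, MeasurableSet {Y | p Y n}) →
      Measurable fun Y => sInf {t : ℕ∞ | ∃ n : ℕ, (n : ℕ∞) = t ∧ p Y n} := by
    intro p hp
    refine measurable_to_countable' fun t => ?_
    induction t using ENat.recTopCoe with
    | top =>
      have : (fun Y => sInf {t : ℕ∞ | ∃ n : ℕ, (n : ℕ∞) = t ∧ p Y n}) ⁻¹' {⊤} =
          ⋂ n, {Y | p Y n}ᶜ := by
        ext Y
        simp only [mem_preimage, mem_singleton_iff, sInf_eq_top, mem_ofPred_eq, mem_iInter,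
          mem_compl_iff]
        constructor
        · intro h n hn
          exact ENat.natCast_ne_top n (h _ ⟨n, rfl, hn⟩)
        · rintro h _ ⟨n, rfl, hn⟩
          exact (h n hn).elim
      rw [this]
      exact MeasurableSet.iInter fun n => (hp n).compl
    | coe N =>
      have : (fun Y => sInf {t : ℕ∞ | ∃ n : ℕ, (n : ℕ∞) = t ∧ p Y n}) ⁻¹' {(N : ℕ∞)} =
          {Y | p Y N} ∩ ⋂ n ∈ Finset.range N, {Y | p Y n}ᶜ := by
        ext Y
        simp only [mem_preimage, mem_singleton_iff, mem_inter_iff, mem_ofPred_eq, mem_iInter,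
          mem_compl_iff, Finset.mem_range]
        by_cases h : ∃ n, p Y n
        · obtain ⟨n, h1, h2, h3⟩ := exists_sInf_natCast_eq h
          rw [h3, Nat.cast_inj]
          constructor
          · rintro rfl
            exact ⟨h1, h2⟩
          · rintro ⟨h4, h5⟩
            by_contra hne
            rcases lt_or_gt_of_ne hne with hlt | hlt
            · exact h5 n hlt h1
            · exact h2 N hlt h4
        · have he : {t : ℕ∞ | ∃ n : ℕ, (n : ℕ∞) = t ∧ p Y n} = ∅ := by
            ext t
            simp only [mem_ofPred_eq, mem_empty_iff_false, iff_false]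
            rintro ⟨n, -, hn⟩
            exact h ⟨n, hn⟩
          rw [he, sInf_empty]
          exact ⟨fun h' => (ENat.natCast_ne_top N h'.symm).elim, fun h' => (h ⟨N, h'.1⟩).elim⟩
      rw [this]
      exact (hp N).inter (Finset.measurableSet_biInter _ fun n _ => (hp n).compl)
  induction m with
  | zero => exact key _ fun n => measurableSet_le measurable_const (measurable_pi_apply n)
  | succ m ih =>
    refine key _ fun n => MeasurableSet.inter (ih ?_)
      (measurableSet_le measurable_const (measurable_pi_apply n))
    exact MeasurableSet.of_discrete (s := {t : ℕ∞ | t < n})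

lemma measurable_obsSeq (k : ℤ) : Measurable (obsSeq k) := by
  refine measurable_pi_iff.2 fun m => ?_
  have : Measurable fun q : (ℕ → ℤ) × ℕ => q.1 q.2 :=
    measurable_from_prod_countable_left fun n => measurable_pi_apply n
  exact this.comp (measurable_id.prodMk
    ((Measurable.of_discrete (f := ENat.toNat)).comp (measurable_tauT k m)))

lemma measurable_xiProc : Measurable xiProc := by
  refine measurable_pi_iff.2 fun k => Measurable.prodMk ?_ ?_
  · exact measurable_pi_iff.2 fun x => (measurable_pi_apply ((x : ℤ) + k)).comp measurable_fst
  · exact measurable_pi_iff.2 fun m => ((measurable_pi_apply m).comp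
      ((measurable_obsSeq k).comp measurable_snd)).sub_const _

/-- First entrance of the walk into `[k, ∞)` after time `a`, starting from a time `a` at which it
is at most `k`. -/
lemma stackWalk_eq_of_lt {d : ℤ → ℕ → Bool} {k : ℤ} {a b : ℕ} (hab : a ≤ b)
    (ha : stackWalk (· - 1) d a ≤ k) (hb : k ≤ stackWalk (· - 1) d b)
    (h : ∀ n, a ≤ n → n < b → stackWalk (· - 1) d n < k) : stackWalk (· - 1) d b = k := by
  rcases hab.eq_or_lt with rfl | hlt
  · omega
  · obtain ⟨c, rfl⟩ : ∃ c, b = c + 1 := ⟨b - 1, by omega⟩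
    have h1 := h c (by omega) (by omega)
    rw [stackWalk_succ] at hb ⊢
    split_ifs at hb ⊢ <;> omega

/-- The part of the walk at sites `≥ k` is the walk reflected at `k`, driven by the same stacks. -/
lemma obsSeq_stackWalk (d : ℤ → ℕ → Bool) (k : ℕ)
    (hio : ∀ N, ∃ n ≥ N, (k : ℤ) ≤ stackWalk (· - 1) d n) (m : ℕ) :
    obsSeq k (stackWalk (· - 1) d) m - k =
      stackWalk (fun z => max (z - 1) 0) (fun z i => d ((z.toNat : ℤ) + k) i) m := by
  set X := stackWalk (· - 1) d with hX
  set e : ℤ → ℕ → Bool := fun z i => d ((z.toNat : ℤ) + k) i with he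
  set r : ℤ → ℤ := fun z => max (z - 1) 0 with hr
  have key : ∃ t : ℕ, tauT k X m = t ∧ k ≤ X t ∧ X t - k = stackWalk r e m ∧
      ∀ z : ℤ, 0 ≤ z → stackVisits (· - 1) d t (z + k) = stackVisits r e m z := by
    induction m with
    | zero =>
      obtain ⟨t, h1, h2, h3⟩ := exists_sInf_natCast_eq (p := fun n => (k : ℤ) ≤ X n)
        ((hio 0).imp fun n hn => hn.2)
      have h4 : ∀ n, 0 ≤ n → n < t → X n < k := fun n _ hn => not_le.1 (h2 n hn)
      have h5 : X t = k := stackWalk_eq_of_lt (Nat.zero_le t)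
        (by rw [stackWalk_zero]; omega) h1 h4
      refine ⟨t, h3, h1, by rw [h5, sub_self, stackWalk_zero], fun z hz => ?_⟩
      rw [stackVisits_eq_of_lt _ _ (by omega : (k : ℤ) ≤ z + k) (Nat.zero_le t) h4,
        stackVisits_zero, stackVisits_zero]
    | succ m ih =>
      obtain ⟨s, hs, hks, hpos, hcnt⟩ := ih
      obtain ⟨t, ⟨h0, h1⟩, h2, h3⟩ := exists_sInf_natCast_eq
        (p := fun n => tauT k X m < (n : ℕ∞) ∧ (k : ℤ) ≤ X n) (by
          obtain ⟨n, hn, hn'⟩ := hio (s + 1)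
          refine ⟨n, ?_, hn'⟩
          rw [hs]
          exact_mod_cast hn)
      rw [hs, Nat.cast_lt] at h0
      have h4 : ∀ n, s + 1 ≤ n → n < t → X n < k := by
        intro n hn hnt
        refine not_le.1 fun hk => h2 n hnt ⟨?_, hk⟩
        rw [hs]
        exact_mod_cast hn
      have hdec : e (stackWalk r e m) (stackVisits r e m (stackWalk r e m)) =
          d (X s) (stackVisits (· - 1) d s (X s)) := by
        have hz : 0 ≤ stackWalk r e m := by omega
        have hXs : X s = stackWalk r e m + k := by omega
        rw [hXs, hcnt _ hz]
        change d (((stackWalk r e m).toNat : ℤ) + k) _ = _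
        rw [Int.toNat_of_nonneg hz]
      refine ⟨t, h3, h1, ?_, fun z hz => ?_⟩
      · have hstep := stackWalk_succ (· - 1) d s
        rw [stackWalk_succ, hdec]
        rw [← hX] at hstep
        by_cases hcase : (k : ℤ) ≤ X (s + 1)
        · have hts : t = s + 1 := by
            by_contra hne
            have := h4 (s + 1) le_rfl (by omega)
            omega
          subst hts
          rw [hstep]
          rw [hstep] at hcase
          split_ifs at hcase ⊢ with hd <;> simp only [hr] at * <;> omega
        · have hXt : X t = k := stackWalk_eq_of_lt (a := s + 1) (by omega)
            (by rw [← hX]; omega) h1 h4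
          rw [hXt]
          rw [hstep] at hcase
          split_ifs at hcase ⊢ with hd <;> simp only [hr] at * <;> omega
      · rw [stackVisits_eq_of_lt _ _ (by omega : (k : ℤ) ≤ z + k) (by omega : s + 1 ≤ t) h4,
          stackVisits_succ, stackVisits_succ, hcnt z hz, ← hX, ← hpos]
        congr 1
        split_ifs <;> omega
  obtain ⟨t, ht, -, hpos, -⟩ := key
  rw [obsSeq, ht, ENat.toNat_natCast, hpos]

section Law

/-- The decisions obtained from the cookie environment `ω` and the uniform variables `U`. -/
def cookieStack (ω : CEnv) (U : ℤ × ℕ → unitInterval) : ℤ → ℕ → Bool :=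
  fun z i => decide ((U (z, i) : ℝ) < ω z i)

/-- The walk in the environment `ω` driven by the uniform variables `U`. -/
def coupledWalk (ω : CEnv) (U : ℤ × ℕ → unitInterval) : ℕ → ℤ :=
  stackWalk (· - 1) (cookieStack ω U)

/-- The law of a family of independent uniform variables. -/
def uniformNoise (ι : Type*) : Measure (ι → unitInterval) :=
  Measure.infinitePi fun _ => volume

instance (ι : Type*) : IsProbabilityMeasure (uniformNoise ι) := by
  unfold uniformNoise
  infer_instance

lemma measurable_cookieStack :
    Measurable fun p : CEnv × (ℤ × ℕ → unitInterval) => cookieStack p.1 p.2 := by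
  refine measurable_pi_iff.2 fun z => measurable_pi_iff.2 fun i => ?_
  refine measurable_to_bool ?_
  simp only [cookieStack, preimage, mem_singleton_iff, decide_eq_true_eq]
  refine measurableSet_lt ?_ ?_
  · exact measurable_subtype_coe.comp ((measurable_pi_apply (z, i)).comp measurable_snd)
  · exact (measurable_pi_apply i).comp ((measurable_pi_apply z).comp measurable_fst)

lemma measurable_coupledWalk :
    Measurable fun p : CEnv × (ℤ × ℕ → unitInterval) => coupledWalk p.1 p.2 :=
  (measurable_stackWalk _).comp measurable_cookieStack

lemma prevVisits_congr {x y : ℕ → ℤ} {n : ℕ} (h : ∀ m ≤ n, x m = y m) :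
    prevVisits x n = prevVisits y n := by
  unfold prevVisits
  congr 1
  refine Finset.filter_congr fun m hm => ?_
  rw [h m (Finset.mem_range.1 hm).le, h n le_rfl]

lemma prevVisits_lt {x : ℕ → ℤ} {m n : ℕ} (hmn : m < n) (h : x m = x n) :
    prevVisits x m < prevVisits x n := by
  refine Finset.card_lt_card (Finset.ssubset_iff_of_subset ?_ |>.2 ⟨m, ?_, ?_⟩)
  · intro j hj
    simp only [Finset.mem_filter, Finset.mem_range] at hj ⊢
    exact ⟨hj.1.trans hmn, hj.2.trans h⟩
  · simp [hmn, h]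
  · simp

lemma injective_prevVisits (x : ℕ → ℤ) : Function.Injective fun m => (x m, prevVisits x m) := by
  intro m n h
  simp only [Prod.mk.injEq] at h
  rcases lt_trichotomy m n with hlt | heq | hlt
  · exact absurd h.2 (prevVisits_lt hlt h.1).ne
  · exact heq
  · exact absurd h.2 (prevVisits_lt hlt h.1.symm).ne'

lemma stackWalk_follows_iff (ℓ : ℤ → ℤ) (d : ℤ → ℕ → Bool) (x : ℕ → ℤ) (n : ℕ) :
    (∀ m ≤ n, stackWalk ℓ d m = x m) ↔
      x 0 = 0 ∧ ∀ m < n, x (m + 1) = if d (x m) (prevVisits x m) then x m + 1 else ℓ (x m) := by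
  induction n with
  | zero => simpa [stackWalk_zero] using eq_comm
  | succ n ih =>
    have hle : (∀ m ≤ n + 1, stackWalk ℓ d m = x m) ↔
        (∀ m ≤ n, stackWalk ℓ d m = x m) ∧ stackWalk ℓ d (n + 1) = x (n + 1) := by
      refine ⟨fun h => ⟨fun m hm => h m (by omega), h _ le_rfl⟩, fun h m hm => ?_⟩
      rcases Nat.le_succ_iff.1 hm with hm | rfl
      · exact h.1 m hm
      · exact h.2
    rw [hle, Nat.forall_lt_succ_right, ← and_assoc, ← ih]
    refine and_congr_right fun h => ?_
    rw [stackWalk_succ, stackVisits_self, prevVisits_congr h, h n le_rfl, eq_comm]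

lemma stepProb_nonneg {ω : CEnv} (hω : IsCookieEnv ω) (x : ℕ → ℤ) (n : ℕ) :
    0 ≤ stepProb ω x n := by
  have := hω (x n) (prevVisits x n)
  unfold stepProb
  split_ifs <;> linarith [this.1, this.2]

lemma cylProb_nonneg {ω : CEnv} (hω : IsCookieEnv ω) (x0 : ℤ) (x : ℕ → ℤ) (n : ℕ) :
    0 ≤ cylProb ω x0 x n :=
  mul_nonneg (by split_ifs <;> norm_num) (Finset.prod_nonneg fun m _ => stepProb_nonneg hω x m)

lemma volume_unitInterval_lt {p : ℝ} (hp : p ∈ Set.Icc (0 : ℝ) 1) :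
    volume {u : unitInterval | (u : ℝ) < p} = ENNReal.ofReal p :=
  unitInterval.volume_Iio ⟨p, hp⟩

lemma volume_unitInterval_not_lt {p : ℝ} (hp : p ∈ Set.Icc (0 : ℝ) 1) :
    volume {u : unitInterval | ¬ (u : ℝ) < p} = ENNReal.ofReal (1 - p) := by
  simp only [not_lt]
  exact unitInterval.volume_Ici ⟨p, hp⟩

lemma volume_step_eq {ω : CEnv} (hω : IsCookieEnv ω) (x : ℕ → ℤ) (m : ℕ) :
    volume {u : unitInterval | x (m + 1) =
      if (u : ℝ) < ω (x m) (prevVisits x m) then x m + 1 else x m - 1} =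
      ENNReal.ofReal (stepProb ω x m) := by
  have hp : ω (x m) (prevVisits x m) ∈ Set.Icc (0 : ℝ) 1 :=
    ⟨by linarith [(hω (x m) (prevVisits x m)).1], (hω _ _).2⟩
  unfold stepProb
  split_ifs with h1 h2
  · rw [← volume_unitInterval_lt hp]
    congr 1
    ext u
    simp only [mem_ofPred_eq]
    grind
  · rw [← volume_unitInterval_not_lt hp]
    congr 1
    ext u
    simp only [mem_ofPred_eq]
    grind
  · rw [ENNReal.ofReal_zero]
    convert measure_empty (μ := (volume : Measure unitInterval))
    ext u
    simp only [mem_ofPred_eq, mem_empty_iff_false, iff_false]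
    split_ifs <;> assumption

lemma uniformNoise_coupledWalk_follows {ω : CEnv} (hω : IsCookieEnv ω) (x : ℕ → ℤ) (n : ℕ) :
    uniformNoise (ℤ × ℕ) {U | ∀ m ≤ n, coupledWalk ω U m = x m} =
      ENNReal.ofReal (cylProb ω 0 x n) := by
  set B : ℕ → Set unitInterval := fun m => {u : unitInterval | x (m + 1) =
      if (u : ℝ) < ω (x m) (prevVisits x m) then x m + 1 else x m - 1} with hB
  have hBm : ∀ m, MeasurableSet (B m) := fun m =>
    measurableSet_eq_fun measurable_const (Measurable.ite
      (measurableSet_lt measurable_subtype_coe measurable_const) measurable_const measurable_const)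
  by_cases h0 : x 0 = 0
  · have hset : {U | ∀ m ≤ n, coupledWalk ω U m = x m} =
        (fun (U : ℤ × ℕ → unitInterval) m => U (x m, prevVisits x m)) ⁻¹'
          Set.pi (Finset.range n) B := by
      ext U
      simp only [mem_ofPred_eq, coupledWalk]
      rw [stackWalk_follows_iff]
      simp [h0, hB, cookieStack, Set.mem_pi]
    have hmeas : Measurable fun (U : ℤ × ℕ → unitInterval) (m : ℕ) => U (x m, prevVisits x m) :=
      measurable_pi_iff.2 fun m => measurable_pi_apply _
    rw [hset, ← Measure.map_apply hmeas
        (MeasurableSet.pi (Finset.countable_toSet _) fun m _ => hBm m), uniformNoise,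
      Measure.map_infinitePi_infinitePi_of_inj (injective_prevVisits x),
      Measure.infinitePi_pi _ fun m _ => hBm m, cylProb, if_pos h0, one_mul,
      ENNReal.ofReal_prod_of_nonneg fun m _ => stepProb_nonneg hω x m]
    exact Finset.prod_congr rfl fun m _ => volume_step_eq hω x m
  · have hset : {U | ∀ m ≤ n, coupledWalk ω U m = x m} = ∅ := by
      ext U
      simp only [mem_ofPred_eq, coupledWalk]
      rw [stackWalk_follows_iff]
      simp [h0]
    rw [hset, cylProb, if_neg h0, zero_mul, measure_empty, ENNReal.ofReal_zero]

lemma isERWLaw_map_coupledWalk {ω : CEnv} (hω : IsCookieEnv ω) :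
    IsERWLaw ω 0 ((uniformNoise (ℤ × ℕ)).map (coupledWalk ω)) := by
  have hm : Measurable (coupledWalk ω) := measurable_coupledWalk.comp measurable_prodMk_left
  refine ⟨Measure.isProbabilityMeasure_map hm.aemeasurable, fun x n => ?_⟩
  rw [← uniformNoise_coupledWalk_follows hω, Measure.map_apply hm]
  · rfl
  · simp only [ofPred_forall]
    exact MeasurableSet.iInter fun m => MeasurableSet.iInter fun _ =>
      measurableSet_eq_fun (measurable_pi_apply m) measurable_const

lemma exists_cylinder_eq_preimage (n : ℕ) (a : Finset.Iic n → ℤ) :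
    ∃ x : ℕ → ℤ, Preorder.frestrictLe (π := fun _ : ℕ => ℤ) n ⁻¹' {a} = {Y : ℕ → ℤ | ∀ m ≤ n, Y m = x m} := by
  refine ⟨fun m => if h : m ≤ n then a ⟨m, Finset.mem_Iic.2 h⟩ else 0, ?_⟩
  ext Y
  simp only [mem_preimage, mem_singleton_iff, mem_ofPred_eq, funext_iff, Subtype.forall,
    Finset.mem_Iic]
  refine forall_congr' fun m => forall_congr' fun hm => ?_
  simp [hm]

lemma IsERWLaw.unique {ω : CEnv} {x0 : ℤ} {P Q : Measure (ℕ → ℤ)} (hP : IsERWLaw ω x0 P)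
    (hQ : IsERWLaw ω x0 Q) : P = Q := by
  have := hP.1
  have := hQ.1
  have hn : ∀ n, P.map (Preorder.frestrictLe n) = Q.map (Preorder.frestrictLe n) := by
    intro n
    refine Measure.ext_iff_singleton.2 fun a => ?_
    obtain ⟨x, hx⟩ := exists_cylinder_eq_preimage n a
    rw [Measure.map_apply (by fun_prop) (measurableSet_singleton a),
      Measure.map_apply (by fun_prop) (measurableSet_singleton a), hx, hP.2, hQ.2]
  refine IsProjectiveLimit.unique (P := fun I : Finset ℕ => Q.map I.restrict) (fun I => ?_)
    fun I => rfl
  have hrestr : ∀ R : Measure (ℕ → ℤ), R.map I.restrict =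
      (R.map (Preorder.frestrictLe (I.sup id))).map
        (Finset.restrict₂ (π := fun _ => ℤ) I.subset_Iic_sup_id) := fun R => by
    rw [Measure.map_map (by fun_prop) (by fun_prop)]
    rfl
  rw [hrestr P, hn, ← hrestr Q]

end Law

section Unbounded

lemma stepProb_congr (ω : CEnv) {x y : ℕ → ℤ} {n : ℕ} (h : ∀ m ≤ n + 1, x m = y m) :
    stepProb ω x n = stepProb ω y n := by
  have hv : prevVisits x n = prevVisits y n := prevVisits_congr fun m hm => h m (by omega)
  unfold stepProb
  rw [hv, h n (by omega), h (n + 1) le_rfl]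

lemma cylProb_congr (ω : CEnv) (x0 : ℤ) {x y : ℕ → ℤ} {n : ℕ} (h : ∀ m ≤ n, x m = y m) :
    cylProb ω x0 x n = cylProb ω x0 y n := by
  unfold cylProb
  rw [h 0 (Nat.zero_le n)]
  congr 1
  refine Finset.prod_congr rfl fun m hm => stepProb_congr ω fun j hj => h j ?_
  have := Finset.mem_range.1 hm
  omega

lemma IsERWLaw.cylinder_inter_step {ω : CEnv} {x0 : ℤ}
    {P : Measure (ℕ → ℤ)} (hP : IsERWLaw ω x0 P) (x : ℕ → ℤ) (n : ℕ) (j : ℤ) :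
    P ({Y | ∀ m ≤ n, Y m = x m} ∩ {Y | Y (n + 1) = Y n + j}) =
      ENNReal.ofReal (cylProb ω x0 x n *
        (if j = 1 then ω (x n) (prevVisits x n)
          else if j = -1 then 1 - ω (x n) (prevVisits x n) else 0)) := by
  set y : ℕ → ℤ := fun m => if m ≤ n then x m else x n + j with hy
  have hyx : ∀ m ≤ n, y m = x m := fun m hm => by simp [hy, hm]
  have hy1 : y (n + 1) = x n + j := by simp [hy]
  have hset : {Y : ℕ → ℤ | ∀ m ≤ n, Y m = x m} ∩ {Y | Y (n + 1) = Y n + j} =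
      {Y | ∀ m ≤ n + 1, Y m = y m} := by
    ext Y
    simp only [mem_inter_iff, mem_ofPred_eq]
    constructor
    · rintro ⟨h1, h2⟩ m hm
      rcases Nat.le_succ_iff.1 hm with hm | rfl
      · rw [h1 m hm, hyx m hm]
      · rw [h2, hy1, h1 n le_rfl]
    · intro h
      have h1 : ∀ m ≤ n, Y m = x m := fun m hm => (h m (by omega)).trans (hyx m hm)
      exact ⟨h1, by rw [h (n + 1) le_rfl, hy1, h1 n le_rfl]⟩
  have hprod : cylProb ω x0 y (n + 1) = cylProb ω x0 y n * stepProb ω y n := by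
    simp only [cylProb, Finset.prod_range_succ, mul_assoc]
  rw [hset, hP.2, hprod, cylProb_congr ω x0 hyx, stepProb, hy1, hyx n le_rfl,
    prevVisits_congr hyx]
  congr 2
  grind

/-- Given the past, the walk is at least as likely to step to the right as to the left. -/
lemma IsERWLaw.inter_step_left_le {ω : CEnv} (hω : IsCookieEnv ω) {x0 : ℤ}
    {P : Measure (ℕ → ℤ)} (hP : IsERWLaw ω x0 P) (n : ℕ) {t : Set (Finset.Iic n → ℤ)}
    (ht : MeasurableSet t) :
    P (Preorder.frestrictLe (π := fun _ : ℕ => ℤ) n ⁻¹' t ∩ {Y | Y (n + 1) = Y n + -1}) ≤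
      P (Preorder.frestrictLe (π := fun _ : ℕ => ℤ) n ⁻¹' t ∩ {Y | Y (n + 1) = Y n + 1}) := by
  have hrepr : ∀ (A : Set (ℕ → ℤ)) (s : Set (Finset.Iic n → ℤ)),
      MeasurableSet s →
      P (Preorder.frestrictLe (π := fun _ : ℕ => ℤ) n ⁻¹' s ∩ A) =
        (P.restrict A).map (Preorder.frestrictLe (π := fun _ : ℕ => ℤ) n) s := by
    intro A s hs
    have hfr : Measurable (Preorder.frestrictLe (π := fun _ : ℕ => ℤ) n) := by fun_prop
    rw [Measure.map_apply hfr hs, Measure.restrict_apply (hfr hs)]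
  rw [hrepr _ t ht, hrepr _ t ht, ← Measure.tsum_indicator_apply_singleton _ t ht,
    ← Measure.tsum_indicator_apply_singleton _ t ht]
  refine ENNReal.tsum_le_tsum fun a => Set.indicator_le_indicator ?_
  obtain ⟨x, hx⟩ := exists_cylinder_eq_preimage n a
  rw [← hrepr _ _ (measurableSet_singleton a), ← hrepr _ _ (measurableSet_singleton a), hx,
    hP.cylinder_inter_step, hP.cylinder_inter_step]
  refine ENNReal.ofReal_le_ofReal (mul_le_mul_of_nonneg_left ?_ (cylProb_nonneg hω _ _ _))
  have := (hω (x n) (prevVisits x n)).1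
  norm_num
  linarith

lemma coupledWalk_step (ω : CEnv) (U : ℤ × ℕ → unitInterval) (n : ℕ) :
    coupledWalk ω U (n + 1) = coupledWalk ω U n + 1 ∨
      coupledWalk ω U (n + 1) = coupledWalk ω U n + -1 := by
  unfold coupledWalk
  rw [stackWalk_succ]
  split_ifs
  · exact Or.inl rfl
  · exact Or.inr (sub_eq_add_neg _ _)

lemma abs_le_of_step {x : ℕ → ℤ} (h0 : x 0 = 0)
    (h : ∀ n, x (n + 1) = x n + 1 ∨ x (n + 1) = x n + -1) (n : ℕ) : |x n| ≤ n := by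
  induction n with
  | zero => simp [h0]
  | succ n ih =>
    rw [abs_le] at ih ⊢
    have := h n
    push_cast
    omega

/-- The walk in a cookie environment, viewed as a real process on the path space, is a
submartingale. -/
lemma IsERWLaw.submartingale {ω : CEnv} (hω : IsCookieEnv ω) {P : Measure (ℕ → ℤ)}
    (hP : IsERWLaw ω 0 P) (h0 : ∀ᵐ Y ∂P, Y 0 = 0)
    (hstep : ∀ᵐ Y ∂P, ∀ n, Y (n + 1) = Y n + 1 ∨ Y (n + 1) = Y n + -1) :
    Submartingale (fun n Y => (Y n : ℝ)) (Filtration.piLE (X := fun _ : ℕ => ℤ)) P := by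
  have := hP.1
  have hmeas : ∀ n, Measurable fun Y : ℕ → ℤ => (Y n : ℝ) := fun n =>
    (measurable_of_countable ((↑) : ℤ → ℝ)).comp (measurable_pi_apply n)
  have hint : ∀ n, Integrable (fun Y : ℕ → ℤ => (Y n : ℝ)) P := by
    intro n
    refine Integrable.of_bound (hmeas n).aestronglyMeasurable (n : ℝ) ?_
    filter_upwards [h0, hstep] with Y hY0 hY
    rw [Real.norm_eq_abs]
    exact_mod_cast abs_le_of_step hY0 hY n
  refine submartingale_of_setIntegral_le_succ (fun n => ?_) hint fun n s hs => ?_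
  · refine Measurable.stronglyMeasurable ?_
    rw [Filtration.piLE_eq_comap_frestrictLe]
    have : (fun Y : ℕ → ℤ => (Y n : ℝ)) = (fun a : Finset.Iic n → ℤ =>
        ((a ⟨n, Finset.mem_Iic.2 le_rfl⟩ : ℤ) : ℝ)) ∘
          Preorder.frestrictLe (π := fun _ : ℕ => ℤ) n := rfl
    rw [this]
    exact (measurable_of_countable _).comp (comap_measurable _)
  · have hs' := hs
    rw [Filtration.piLE_eq_comap_frestrictLe] at hs'
    obtain ⟨t, ht, rfl⟩ := hs'
    set s := Preorder.frestrictLe (π := fun _ : ℕ => ℤ) n ⁻¹' t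
    have hsm : MeasurableSet s := (Filtration.piLE (X := fun _ : ℕ => ℤ)).le n _ hs
    set A : ℤ → Set (ℕ → ℤ) := fun j => {Y | Y (n + 1) = Y n + j} with hA
    have hAm : ∀ j, MeasurableSet (A j) := fun j => measurableSet_eq_fun (measurable_pi_apply (n + 1))
      (Measurable.add_const (f := fun Y : ℕ → ℤ => Y n) (measurable_pi_apply n) j)
    rw [← sub_nonneg, ← integral_sub (hint _).integrableOn (hint _).integrableOn]
    have hae : ∀ᵐ Y ∂P.restrict s, (Y (n + 1) : ℝ) - Y n =
        (A 1).indicator (fun _ => (1 : ℝ)) Y - (A (-1)).indicator (fun _ => (1 : ℝ)) Y := by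
      refine ae_restrict_of_ae ?_
      filter_upwards [hstep] with Y hY
      simp only [hA, Set.indicator_apply, mem_ofPred_eq]
      rcases hY n with h | h <;> simp [h]
    rw [integral_congr_ae hae, integral_sub, integral_indicator_const _ (hAm 1),
      integral_indicator_const _ (hAm (-1))]
    · simp only [smul_eq_mul, mul_one, sub_nonneg]
      rw [measureReal_restrict_apply (hAm _), measureReal_restrict_apply (hAm _),
        Set.inter_comm, Set.inter_comm (A 1)]
      exact ENNReal.toReal_mono (measure_ne_top _ _) (hP.inter_step_left_le hω n ht)
    · exact (integrable_const _).indicator (hAm _)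
    · exact (integrable_const _).indicator (hAm _)

lemma not_tendsto_of_step {x : ℕ → ℤ} (h : ∀ n, x (n + 1) = x n + 1 ∨ x (n + 1) = x n + -1)
    (c : ℝ) : ¬ Tendsto (fun n => (x n : ℝ)) atTop (𝓝 c) := by
  intro hc
  have h1 : Tendsto (fun n => (x (n + 1) : ℝ) - x n) atTop (𝓝 (c - c)) :=
    (hc.comp (tendsto_add_atTop_nat 1)).sub hc
  rw [sub_self] at h1
  obtain ⟨n, hn⟩ := ((Metric.tendsto_nhds.1 h1) 1 one_pos).exists
  rcases h n with h | h <;> simp [h] at hn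

/-- The walk in a cookie environment is almost surely unbounded above. -/
lemma ae_coupledWalk_unbounded {ω : CEnv} (hω : IsCookieEnv ω) :
    ∀ᵐ U ∂uniformNoise (ℤ × ℕ), ∀ K : ℤ, ∃ n, K ≤ coupledWalk ω U n := by
  have hm : Measurable (coupledWalk ω) := measurable_coupledWalk.comp measurable_prodMk_left
  set P := (uniformNoise (ℤ × ℕ)).map (coupledWalk ω)
  have hP : IsERWLaw ω 0 P := isERWLaw_map_coupledWalk hω
  have := hP.1
  have h0 : ∀ᵐ Y ∂P, Y 0 = 0 := by
    refine (ae_map_iff hm.aemeasurable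
      (measurableSet_eq_fun (measurable_pi_apply 0) measurable_const)).2 (ae_of_all _ fun U => ?_)
    exact stackWalk_zero _ _
  have hstep : ∀ᵐ Y ∂P, ∀ n, Y (n + 1) = Y n + 1 ∨ Y (n + 1) = Y n + -1 := by
    refine ae_all_iff.2 fun n => (ae_map_iff hm.aemeasurable (MeasurableSet.union ?_ ?_)).2
      (ae_of_all _ fun U => coupledWalk_step ω U n) <;>
    exact measurableSet_eq_fun (measurable_pi_apply _) ((measurable_pi_apply n).add_const _)
  have hbdd : ∀ᵐ Y ∂P, ∀ n, |((Y (n + 1) : ℤ) : ℝ) - (Y n : ℤ)| ≤ (1 : NNReal) := by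
    filter_upwards [hstep] with Y hY n
    rcases hY n with h | h <;> simp [h]
  have hconv := (hP.submartingale hω h0 hstep).bddAbove_iff_exists_tendsto hbdd
  have hnot : ∀ᵐ Y ∂P, ¬ BddAbove (Set.range fun n => ((Y n : ℤ) : ℝ)) := by
    filter_upwards [hconv, hstep] with Y h1 h2 h3
    obtain ⟨c, hc⟩ := h1.1 h3
    exact not_tendsto_of_step h2 c hc
  filter_upwards [ae_of_ae_map hm.aemeasurable hnot] with U hU K
  by_contra! hK
  refine hU ⟨K, ?_⟩
  rintro _ ⟨n, rfl⟩
  exact Int.cast_le.2 (hK n).le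

lemma frequently_le_of_unbounded {x : ℕ → ℤ} (h : ∀ K : ℤ, ∃ n, K ≤ x n) (k : ℤ) (N : ℕ) :
    ∃ n ≥ N, k ≤ x n := by
  by_contra! hN
  obtain ⟨M, hM⟩ := ((Finset.range N).image x).bddAbove
  obtain ⟨n, hn⟩ := h (max k (M + 1))
  rcases lt_or_ge n N with hlt | hge
  · have := hM (Finset.mem_coe.2 (Finset.mem_image_of_mem x (Finset.mem_range.2 hlt)))
    omega
  · have := hN n hge
    omega

end Unbounded

section Ergodic

lemma semiconj_orbit {α β : Type*} (S : α → α) (F : α → β) :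
    Function.Semiconj (fun a k => F (S^[k] a)) S shiftSeq := fun a => by
  funext k
  simp [shiftSeq]

variable {α β : Type*} [MeasurableSpace α] [MeasurableSpace β]

lemma measurable_shiftSeq : Measurable (shiftSeq (α := α)) :=
  measurable_pi_iff.2 fun n => measurable_pi_apply (n + 1)

lemma measurePreserving_orbit {μ : Measure α} {S : α → α} (hS : Measurable S) {F : α → β}
    (hF : Measurable F) :
    MeasurePreserving (fun a k => F (S^[k] a)) μ (μ.map fun a k => F (S^[k] a)) :=
  (measurable_pi_iff.2 fun k => hF.comp (hS.iterate k)).measurePreserving μ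

/-- The observations of a factor along the orbits of a measure preserving map are stationary. -/
lemma MeasureTheory.MeasurePreserving.shiftSeq_map_orbit {μ : Measure α} {S : α → α}
    (hS : MeasurePreserving S μ μ) {F : α → β} (hF : Measurable F) :
    MeasurePreserving shiftSeq (μ.map fun a k => F (S^[k] a)) (μ.map fun a k => F (S^[k] a)) :=
  (measurePreserving_orbit hS.measurable hF).of_semiconj hS (semiconj_orbit S F)
    measurable_shiftSeq

/-- The observations of a factor along the orbits of an ergodic map are ergodic. -/
lemma Ergodic.shiftSeq_map_orbit {μ : Measure α} {S : α → α} (hS : Ergodic S μ) {F : α → β}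
    (hF : Measurable F) : Ergodic shiftSeq (μ.map fun a k => F (S^[k] a)) :=
  (measurePreserving_orbit hS.measurable hF).ergodic_of_ergodic_semiconj hS
    measurable_shiftSeq (semiconj_orbit S F)

/-- The shift of a noise indexed by sites and visits by one site. -/
def noiseShift (U : ℕ × ℕ → unitInterval) : ℕ × ℕ → unitInterval := fun q => U (q.1 + 1, q.2)

lemma noiseShift_iterate (n : ℕ) (U : ℕ × ℕ → unitInterval) (q : ℕ × ℕ) :
    noiseShift^[n] U q = U (q.1 + n, q.2) := by
  induction n generalizing U with
  | zero => rfl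
  | succ n ih =>
    rw [Function.iterate_succ_apply, ih, noiseShift]
    congr 2

lemma measurePreserving_noiseShift :
    MeasurePreserving noiseShift (uniformNoise (ℕ × ℕ)) (uniformNoise (ℕ × ℕ)) where
  measurable := measurable_pi_iff.2 fun _ => measurable_pi_apply _
  map_eq := Measure.map_infinitePi_infinitePi_of_inj
    (f := fun q : ℕ × ℕ => (q.1 + 1, q.2)) fun a b h => by
      simp only [Prod.mk.injEq, Nat.add_right_cancel_iff] at h
      exact Prod.ext h.1 h.2

/-- **Kolmogorov's zero-one law** for events that do not depend on any finite number of sites. -/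
lemma uniformNoise_zero_or_one {A : Set (ℕ × ℕ → unitInterval)}
    (hA : ∀ n, ∃ B, MeasurableSet B ∧ noiseShift^[n] ⁻¹' B = A) :
    uniformNoise (ℕ × ℕ) A = 0 ∨ uniformNoise (ℕ × ℕ) A = 1 := by
  set s : ℕ × ℕ → MeasurableSpace (ℕ × ℕ → unitInterval) := fun q =>
    MeasurableSpace.comap (fun U => U q) inferInstance with hs
  have hindep : iIndep s (uniformNoise (ℕ × ℕ)) :=
    (iIndepFun_infinitePi (X := fun _ u => u) fun _ => measurable_id).iIndep
  refine measure_zero_or_one_of_measurableSet_limsup (f := comap Prod.fst atTop)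
    (p := fun t => ∃ N : ℕ, t ⊆ {q | q.1 < N}) (ns := fun N : ℕ => {q : ℕ × ℕ | q.1 < N})
    (fun q => (measurable_pi_apply q).comap_le) hindep ?_ ?_ (fun N => ⟨N, le_rfl⟩)
    (fun q => ⟨q.1 + 1, Nat.lt_succ_self _⟩) ?_
  · rintro t ⟨N, ht⟩
    refine mem_of_superset (preimage_mem_comap (Ici_mem_atTop N)) fun q hq hqt => ?_
    have hlt : q.1 < N := ht hqt
    exact absurd hq (not_le.2 hlt)
  · exact Monotone.directed_le fun M N hMN q hq => lt_of_lt_of_le hq hMN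
  · rw [limsup_eq, MeasurableSpace.measurableSet_sInf]
    intro m hm
    rw [mem_ofPred_eq, eventually_comap] at hm
    obtain ⟨N, hN⟩ := eventually_atTop.1 hm
    obtain ⟨B, hB, rfl⟩ := hA N
    have hmeas : Measurable[m, MeasurableSpace.pi] (noiseShift^[N]) := by
      refine (@measurable_pi_iff _ _ _ m _ _).2 fun q => ?_
      simp only [noiseShift_iterate]
      exact (comap_measurable _).mono (hN (q.1 + N) (Nat.le_add_left _ _) _ rfl) le_rfl
    exact hmeas hB

lemma Ergodic.prodMap_noiseShift {μ : Measure α} [IsProbabilityMeasure μ] {S : α → α}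
    (hS : Ergodic S μ) :
    Ergodic (Prod.map S noiseShift) (μ.prod (uniformNoise (ℕ × ℕ))) where
  toMeasurePreserving := hS.toMeasurePreserving.prod measurePreserving_noiseShift
  aeconst_set A hA hinv := by
    set lam := uniformNoise (ℕ × ℕ)
    have hinvn : ∀ n, (Prod.map S noiseShift)^[n] ⁻¹' A = A := fun n =>
      (Function.IsFixedPt.preimage_iterate hinv n)
    have hsec : ∀ a, MeasurableSet (Prod.mk a ⁻¹' A) := fun a => measurable_prodMk_left hA
    have hsecn : ∀ a n, noiseShift^[n] ⁻¹' (Prod.mk (S^[n] a) ⁻¹' A) = Prod.mk a ⁻¹' A := by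
      intro a n
      conv_rhs => rw [← hinvn n]
      ext U
      simp [Prod.map_iterate]
    have h01 : ∀ a, lam (Prod.mk a ⁻¹' A) = 0 ∨ lam (Prod.mk a ⁻¹' A) = 1 := fun a =>
      uniformNoise_zero_or_one fun n => ⟨_, hsec _, hsecn a n⟩
    have hmeas : Measurable fun a => lam (Prod.mk a ⁻¹' A) := measurable_measure_prodMk_left hA
    set D : Set α := {a | lam (Prod.mk a ⁻¹' A) = 0}
    have hD : MeasurableSet D := hmeas (measurableSet_singleton 0)
    have hDinv : S ⁻¹' D = D := by
      ext a
      have : lam (Prod.mk a ⁻¹' A) = lam (Prod.mk (S a) ⁻¹' A) := by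
        rw [← measurePreserving_noiseShift.measure_preimage (hsec (S a)).nullMeasurableSet,
          ← hsecn a 1]
        rfl
      simp [D, this]
    rw [eventuallyConst_set']
    rcases hS.toPreErgodic.ae_mem_or_ae_notMem hD hDinv with h | h
    · left
      rw [ae_eq_empty, Measure.measure_prod_null hA]
      exact h
    · right
      rw [ae_eq_univ, Measure.measure_prod_null hA.compl]
      filter_upwards [h] with a ha
      rw [preimage_compl, Pi.zero_apply, prob_compl_eq_zero_iff (hsec a)]
      exact (h01 a).resolve_left ha

end Ergodic

section Factor

/-- The environment at the nonnegative sites together with the walk reflected at `0` that it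
drives. -/
def reflectedPair (v : (ℕ → ℕ → ℝ) × (ℕ × ℕ → unitInterval)) : (ℕ → ℕ → ℝ) × (ℕ → ℤ) :=
  (v.1, stackWalk (fun z => max (z - 1) 0)
    fun z i => decide ((v.2 (z.toNat, i) : ℝ) < v.1 z.toNat i))

/-- The restriction of an environment and a noise to the nonnegative sites. -/
def restrictPair (p : CEnv × (ℤ × ℕ → unitInterval)) :
    (ℕ → ℕ → ℝ) × (ℕ × ℕ → unitInterval) :=
  (restrictNN p.1, fun q => p.2 (q.1, q.2))

lemma measurable_restrictNN : Measurable restrictNN :=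
  measurable_pi_iff.2 fun x => measurable_pi_apply (x : ℤ)

lemma measurable_reflectedPair : Measurable reflectedPair := by
  refine measurable_fst.prodMk ((measurable_stackWalk _).comp ?_)
  refine measurable_pi_iff.2 fun z => measurable_pi_iff.2 fun i => measurable_to_bool ?_
  simp only [preimage, mem_singleton_iff, decide_eq_true_eq]
  refine measurableSet_lt ?_ ?_
  · exact measurable_subtype_coe.comp ((measurable_pi_apply (z.toNat, i)).comp measurable_snd)
  · exact (measurable_pi_apply i).comp ((measurable_pi_apply z.toNat).comp measurable_fst)

lemma measurePreserving_restrictPair (Pr : Measure CEnv) [IsProbabilityMeasure Pr] :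
    MeasurePreserving restrictPair (Pr.prod (uniformNoise (ℤ × ℕ)))
      ((Pr.map restrictNN).prod (uniformNoise (ℕ × ℕ))) := by
  have := Measure.isProbabilityMeasure_map (μ := Pr) measurable_restrictNN.aemeasurable
  refine (measurable_restrictNN.measurePreserving Pr).prod
    ⟨measurable_pi_iff.2 fun _ => measurable_pi_apply _, ?_⟩
  refine Measure.map_infinitePi_infinitePi_of_inj
    (f := fun q : ℕ × ℕ => ((q.1 : ℤ), q.2)) fun a b h => ?_
  simp only [Prod.mk.injEq, Nat.cast_inj] at h
  exact Prod.ext h.1 h.2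

lemma shiftSeq_iterate {α : Type*} (n : ℕ) (u : ℕ → α) (x : ℕ) :
    shiftSeq^[n] u x = u (x + n) := by
  induction n generalizing u with
  | zero => rfl
  | succ n ih =>
    rw [Function.iterate_succ_apply, ih, shiftSeq]
    congr 1

/-- The process `ξ` of the coupled walk is a factor of the shift of environment and noise. -/
lemma xiProc_coupledWalk {p : CEnv × (ℤ × ℕ → unitInterval)}
    (hp : ∀ K : ℤ, ∃ n, K ≤ coupledWalk p.1 p.2 n) (k : ℕ) :
    xiProc (p.1, coupledWalk p.1 p.2) k =
      reflectedPair ((Prod.map shiftSeq noiseShift)^[k] (restrictPair p)) := by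
  have h1 : shiftSeq^[k] (restrictNN p.1) = fun x : ℕ => p.1 ((x : ℤ) + k) := by
    funext x
    rw [shiftSeq_iterate, restrictNN]
    push_cast
    rfl
  have h2 : noiseShift^[k] (fun q => p.2 (q.1, q.2)) =
      fun q : ℕ × ℕ => p.2 ((q.1 : ℤ) + k, q.2) := by
    funext q
    rw [noiseShift_iterate]
    push_cast
    rfl
  rw [Prod.map_iterate, restrictPair, Prod.map_apply, h1, h2]
  refine Prod.ext rfl (funext fun m => ?_)
  exact obsSeq_stackWalk (cookieStack p.1 p.2) k (frequently_le_of_unbounded hp k) m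

lemma ae_prod_coupledWalk_unbounded {Pr : Measure CEnv}
    (hcookie : ∀ᵐ ω ∂Pr, IsCookieEnv ω) :
    ∀ᵐ p ∂Pr.prod (uniformNoise (ℤ × ℕ)), ∀ K : ℤ, ∃ n, K ≤ coupledWalk p.1 p.2 n := by
  have hmeas : MeasurableSet {p : CEnv × (ℤ × ℕ → unitInterval) |
      ∀ K : ℤ, ∃ n, K ≤ coupledWalk p.1 p.2 n} := by
    simp only [ofPred_forall, ofPred_exists]
    exact MeasurableSet.iInter fun K => MeasurableSet.iUnion fun n =>
      measurableSet_le measurable_const ((measurable_pi_apply n).comp measurable_coupledWalk)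
  rw [Measure.ae_prod_iff_ae_ae hmeas]
  filter_upwards [hcookie] with ω hω using ae_coupledWalk_unbounded hω

/-- The annealed law is the law of the environment and the coupled walk. -/
lemma compProd_eq_map_coupledWalk {Pr : Measure CEnv} [IsProbabilityMeasure Pr]
    (hcookie : ∀ᵐ ω ∂Pr, IsCookieEnv ω)
    (κ : Kernel CEnv (ℕ → ℤ)) [IsMarkovKernel κ]
    (hκ : ∀ ω, IsCookieEnv ω → IsERWLaw ω 0 (κ ω)) :
    Pr.compProd κ =
      (Pr.prod (uniformNoise (ℤ × ℕ))).map fun p => (p.1, coupledWalk p.1 p.2) := by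
  have hm := measurable_fst.prodMk measurable_coupledWalk
  ext s hs
  rw [Measure.compProd_apply hs, Measure.map_apply hm hs, Measure.prod_apply (hm hs)]
  refine lintegral_congr_ae ?_
  filter_upwards [hcookie] with ω hω
  have hω' : Measurable (coupledWalk ω) := measurable_coupledWalk.comp measurable_prodMk_left
  rw [(hκ ω hω).unique (isERWLaw_map_coupledWalk hω),
    Measure.map_apply hω' (measurable_prodMk_left hs)]
  rfl

lemma map_xiProc_eq {Pr : Measure CEnv} [IsProbabilityMeasure Pr]
    (hcookie : ∀ᵐ ω ∂Pr, IsCookieEnv ω)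
    (κ : Kernel CEnv (ℕ → ℤ)) [IsMarkovKernel κ]
    (hκ : ∀ ω, IsCookieEnv ω → IsERWLaw ω 0 (κ ω)) {γ : Type*} [MeasurableSpace γ]
    {g : (ℕ → ℕ → ℝ) × (ℕ → ℤ) → γ} (hg : Measurable g) :
    (Pr.compProd κ).map (fun p k => g (xiProc p k)) =
      ((Pr.map restrictNN).prod (uniformNoise (ℕ × ℕ))).map
        fun v k => (g ∘ reflectedPair) ((Prod.map shiftSeq noiseShift)^[k] v) := by
  have hS : Measurable (Prod.map (shiftSeq (α := ℕ → ℝ)) noiseShift) :=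
    measurable_shiftSeq.prodMap measurePreserving_noiseShift.measurable
  have hξ : Measurable fun (p : CEnv × (ℕ → ℤ)) (k : ℕ) => g (xiProc p k) :=
    measurable_pi_iff.2 fun k => hg.comp ((measurable_pi_apply k).comp measurable_xiProc)
  have hpair : Measurable fun p : CEnv × (ℤ × ℕ → unitInterval) =>
      (p.1, coupledWalk p.1 p.2) :=
    measurable_fst.prodMk measurable_coupledWalk
  have horbit : Measurable fun (v : (ℕ → ℕ → ℝ) × (ℕ × ℕ → unitInterval)) (k : ℕ) =>
      (g ∘ reflectedPair) ((Prod.map shiftSeq noiseShift)^[k] v) :=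
    measurable_pi_iff.2 fun k => (hg.comp measurable_reflectedPair).comp (hS.iterate k)
  rw [compProd_eq_map_coupledWalk hcookie κ hκ, Measure.map_map hξ hpair,
    ← (measurePreserving_restrictPair Pr).map_eq,
    Measure.map_map horbit (measurePreserving_restrictPair Pr).measurable]
  refine Measure.map_congr ?_
  filter_upwards [ae_prod_coupledWalk_unbounded hcookie] with p hp
  funext k
  exact congrArg g (xiProc_coupledWalk hp k)

end Factor

/-- Lemma 13. If `(ω(x))_{x≥0}` is stationary (resp. stationary and
ergodic) under `Pr`, then the process `ξ = (ξ_k)_{k≥0}`,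
`ξ_k = ((ω(x+k))_{x≥0}, (X_{τ_{k,m}} − k)_{m≥0})`, is stationary (resp. stationary and
ergodic) under the annealed measure `P_0`; in particular so is `(g(ξ_k))_{k≥0}` for any
measurable `g`. -/
theorem erw_xi_stationary_ergodic (Pr : Measure CEnv) [IsProbabilityMeasure Pr]
    (hcookie : ∀ᵐ ω ∂Pr, IsCookieEnv ω)
    (κ : Kernel CEnv (ℕ → ℤ)) [IsMarkovKernel κ]
    (hκ : ∀ ω, IsCookieEnv ω → IsERWLaw ω 0 (κ ω)) :
    (IsStationaryEnv Pr →
      MeasurePreserving shiftSeq ((Pr.compProd κ).map (fun p => xiProc p))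
          ((Pr.compProd κ).map (fun p => xiProc p)) ∧
        ∀ (γ : Type) [MeasurableSpace γ] (g : (ℕ → ℕ → ℝ) × (ℕ → ℤ) → γ), Measurable g →
          MeasurePreserving shiftSeq
            ((Pr.compProd κ).map (fun p k => g (xiProc p k)))
            ((Pr.compProd κ).map (fun p k => g (xiProc p k)))) ∧
    (IsStatErgEnv Pr →
      Ergodic shiftSeq ((Pr.compProd κ).map (fun p => xiProc p)) ∧
        ∀ (γ : Type) [MeasurableSpace γ] (g : (ℕ → ℕ → ℝ) × (ℕ → ℤ) → γ), Measurable g →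
          Ergodic shiftSeq ((Pr.compProd κ).map (fun p k => g (xiProc p k)))) := by
  have := Measure.isProbabilityMeasure_map (μ := Pr) measurable_restrictNN.aemeasurable
  have hstat : IsStationaryEnv Pr → ∀ (γ : Type) [MeasurableSpace γ]
      (g : (ℕ → ℕ → ℝ) × (ℕ → ℤ) → γ), Measurable g →
      MeasurePreserving shiftSeq ((Pr.compProd κ).map (fun p k => g (xiProc p k)))
        ((Pr.compProd κ).map (fun p k => g (xiProc p k))) := by
    intro h γ _ g hg
    rw [map_xiProc_eq hcookie κ hκ hg]
    exact (MeasurePreserving.prod h measurePreserving_noiseShift).shiftSeq_map_orbit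
      (hg.comp measurable_reflectedPair)
  have herg : IsStatErgEnv Pr → ∀ (γ : Type) [MeasurableSpace γ]
      (g : (ℕ → ℕ → ℝ) × (ℕ → ℤ) → γ), Measurable g →
      Ergodic shiftSeq ((Pr.compProd κ).map (fun p k => g (xiProc p k))) := by
    intro h γ _ g hg
    rw [map_xiProc_eq hcookie κ hκ hg]
    exact (Ergodic.prodMap_noiseShift h).shiftSeq_map_orbit (hg.comp measurable_reflectedPair)
  exact ⟨fun h => ⟨hstat h _ id measurable_id, hstat h⟩,
    fun h => ⟨herg h _ id measurable_id, herg h⟩⟩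

end
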